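/- Let n₁, …, n_k ≥ 2 be pairwise relatively prime integers. For each j, let I_{n_j} be the two-sided ideal of ℤ⟨x,y⟩ generated by r_{1,n_j}, r_{2,n_j}, and s_i for 1 ≤ i ≤ n_j − 1 (so that I_{n_j} is the kernel of the homomorphism φ_{n_j} : ℤ⟨x,y⟩ → M_{n_j}(ℤ) sending x ↦ X, y ↦ Y). Then the ring homomorphism Φ : ℤ⟨x,y⟩ → ∏_{j=1}^{k} M_{n_j}(ℤ) whose j-th component is φ_{n_j} is surjective; consequently ℤ⟨x,y⟩ / (⋂_{j=1}^{k} I_{n_j}) ≅ ⊕_{j=1}^{k} M_{n_j}(ℤ). -/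

import Mathlib

/-- The `n × n` cyclic permutation matrix `X = E₂₁ + E₃₂ + ⋯ + E_{n,n-1} + E_{1n}`,
with `X i j = 1` iff `i ≡ j + 1 (mod n)`. -/
def Xmat (n : ℕ) : Matrix (Fin n) (Fin n) ℤ :=
  Matrix.of fun i j => if (i : ℕ) = ((j : ℕ) + 1) % n then 1 else 0

/-- The matrix unit `Y = E₁₁`. -/
def Ymat (n : ℕ) : Matrix (Fin n) (Fin n) ℤ :=
  Matrix.of fun i j => if (i : ℕ) = 0 ∧ (j : ℕ) = 0 then 1 else 0

/-- The generator `x` of the free ring `ℤ⟨x,y⟩ = FreeAlgebra ℤ (Fin 2)`. -/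
noncomputable def fx : FreeAlgebra ℤ (Fin 2) := FreeAlgebra.ι ℤ 0

/-- The generator `y` of the free ring `ℤ⟨x,y⟩ = FreeAlgebra ℤ (Fin 2)`. -/
noncomputable def fy : FreeAlgebra ℤ (Fin 2) := FreeAlgebra.ι ℤ 1

/-- The ring homomorphism `φₙ : ℤ⟨x,y⟩ → Mₙ(ℤ)` sending `x ↦ X`, `y ↦ Y`. -/
noncomputable def phi (n : ℕ) : FreeAlgebra ℤ (Fin 2) →ₐ[ℤ] Matrix (Fin n) (Fin n) ℤ :=
  FreeAlgebra.lift ℤ ![Xmat n, Ymat n]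

/-- `r_{1,n} = xⁿ - 1`. -/
noncomputable def r1 (n : ℕ) : FreeAlgebra ℤ (Fin 2) := fx ^ n - 1

/-- `r_{2,n} = (Σ_{i=0}^{n-1} x^{n-i} y x^i) - 1`. -/
noncomputable def r2 (n : ℕ) : FreeAlgebra ℤ (Fin 2) :=
  (∑ i ∈ Finset.range n, fx ^ (n - i) * fy * fx ^ i) - 1

/-- `s₀ = y² - y`. -/
noncomputable def s0 : FreeAlgebra ℤ (Fin 2) := fy ^ 2 - fy

/-- `s_j = y x^j y`. -/
noncomputable def s (j : ℕ) : FreeAlgebra ℤ (Fin 2) := fy * fx ^ j * fy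

/-- The ideal `I_n = (r_{1,n}, r_{2,n}, s_1, …, s_{n-1})` of `ℤ⟨x,y⟩`,
the kernel of `phi n`. -/
noncomputable def Igen (n : ℕ) : TwoSidedIdeal (FreeAlgebra ℤ (Fin 2)) :=
  TwoSidedIdeal.span ({r1 n, r2 n} ∪ { a | ∃ j, 1 ≤ j ∧ j ≤ n - 1 ∧ a = s j })

lemma mul_Xmat_apply {n : ℕ} (M : Matrix (Fin n) (Fin n) ℤ) (i j : Fin n) :
    (M * Xmat n) i j = M i ⟨(j + 1) % n, Nat.mod_lt _ j.pos⟩ := by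
  rw [Matrix.mul_apply, Finset.sum_eq_single ⟨(j + 1) % n, Nat.mod_lt _ j.pos⟩]
  · simp [Xmat]
  · intro l _ hl
    have : (l : ℕ) ≠ (j + 1) % n := fun h => hl (Fin.ext h)
    simp [Xmat, this]
  · simp

lemma Xmat_pow_apply (n a : ℕ) (i j : Fin n) :
    (Xmat n ^ a) i j = if (i : ℕ) = (j + a) % n then 1 else 0 := by
  induction a generalizing j with
  | zero => simp [Matrix.one_apply, Fin.ext_iff, Nat.mod_eq_of_lt]
  | succ a ih =>
    rw [pow_succ, mul_Xmat_apply, ih]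
    simp [add_assoc, add_comm 1 a]

lemma Xmat_pow_self (n : ℕ) : Xmat n ^ n = 1 := by
  ext i j
  simp [Xmat_pow_apply, Matrix.one_apply, Fin.ext_iff, Nat.mod_eq_of_lt]

lemma Ymat_eq_single {n : ℕ} (hn : 0 < n) :
    Ymat n = Matrix.single ⟨0, hn⟩ ⟨0, hn⟩ 1 := by
  ext i j
  simp [Ymat, Matrix.single_apply, Fin.ext_iff, eq_comm]

lemma mul_single_one_apply {n : ℕ} (M : Matrix (Fin n) (Fin n) ℤ) (p q i j : Fin n) :
    (M * Matrix.single p q (1 : ℤ)) i j = if q = j then M i p else 0 := by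
  split_ifs with h
  · subst h; simp
  · exact (Matrix.mul_single_apply_of_ne _ _ _ _ _ (Ne.symm h) _).trans rfl

lemma single_one_mul_apply {n : ℕ} (M : Matrix (Fin n) (Fin n) ℤ) (p q i j : Fin n) :
    (Matrix.single p q (1 : ℤ) * M) i j = if p = i then M q j else 0 := by
  split_ifs with h
  · subst h; simp
  · exact (Matrix.single_mul_apply_of_ne _ _ _ _ _ (Ne.symm h) _).trans rfl

lemma Xmat_mul_single {n : ℕ} (p q : Fin n) :
    Xmat n * Matrix.single p q 1 =
      Matrix.single ⟨(p + 1) % n, Nat.mod_lt _ p.pos⟩ q (1 : ℤ) := by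
  ext i j
  rw [mul_single_one_apply, Matrix.single_apply]
  by_cases h : q = j <;> simp [h, Xmat, Fin.ext_iff, eq_comm]

lemma Ymat_mul_single {n : ℕ} (p q : Fin n) :
    Ymat n * Matrix.single p q 1 =
      if (p : ℕ) = 0 then Matrix.single ⟨0, p.pos⟩ q (1 : ℤ) else 0 := by
  rw [Ymat_eq_single p.pos]
  split_ifs with h
  · have : p = ⟨0, p.pos⟩ := Fin.ext h
    rw [← this, Matrix.single_mul_single_same, one_mul]
  · rw [Matrix.single_mul_single_of_ne]
    exact fun h' => h (congrArg Fin.val h').symm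

lemma Ymat_mul_Xmat_pow_mul_Ymat {n : ℕ} (c : ℕ) :
    Ymat n * Xmat n ^ c * Ymat n = if n ∣ c then Ymat n else 0 := by
  rcases Nat.eq_zero_or_pos n with rfl | hn
  · ext i; exact i.elim0
  rw [Ymat_eq_single hn]
  ext i j
  rw [mul_single_one_apply, single_one_mul_apply, Xmat_pow_apply]
  simp only [zero_add, Nat.dvd_iff_mod_eq_zero]
  by_cases h : c % n = 0 <;>
    simp [h, Matrix.single_apply, eq_comm, ← ite_and, and_comm]

lemma Xmat_pow_mul_Ymat_mul_Xmat_pow {n : ℕ} (p q : Fin n) :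
    Xmat n ^ (p : ℕ) * Ymat n * Xmat n ^ (n - q : ℕ) = Matrix.single p q 1 := by
  rw [Ymat_eq_single p.pos]
  ext i j
  rw [Matrix.mul_apply, Finset.sum_eq_single ⟨0, p.pos⟩]
  · rw [mul_single_one_apply, Xmat_pow_apply, Xmat_pow_apply, Matrix.single_apply]
    have h : 0 = (j + (n - q : ℕ)) % n ↔ q = j := by
      rw [eq_comm, ← Nat.dvd_iff_mod_eq_zero, Fin.ext_iff]
      constructor
      · rintro ⟨c, hc⟩
        have : c = 1 := by
          have h1 : n * c < n * 2 := by omega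
          have h2 : 0 < n * c := by omega
          have := Nat.lt_of_mul_lt_mul_left h1
          have := Nat.pos_of_mul_pos_left h2
          omega
        subst this
        omega
      · intro h
        exact ⟨1, by omega⟩
    simp only [h]
    by_cases h' : q = j <;> simp [h', Fin.ext_iff, Nat.mod_eq_of_lt, eq_comm]
  · intro l _ hl
    rw [mul_single_one_apply, if_neg (Ne.symm hl), zero_mul]
  · simp

lemma sum_conj_pow_eq {R : Type*} [Ring R] {x : R} (y : R) {n : ℕ} (hx : x ^ n = 1) :
    ∑ i ∈ Finset.range n, x ^ (n - i) * y * x ^ i =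
      ∑ p : Fin n, x ^ (p : ℕ) * y * x ^ (n - p : ℕ) := by
  rw [Fin.sum_univ_eq_sum_range fun p => x ^ p * y * x ^ (n - p),
    ← Finset.sum_range_reflect (fun p => x ^ p * y * x ^ (n - p))]
  have h := (Finset.sum_range_succ (fun i => x ^ (n - i) * y * x ^ i) n).symm.trans
    (Finset.sum_range_succ' _ n)
  simp only [Nat.sub_self, pow_zero, one_mul, mul_one, Nat.sub_zero, hx, add_left_inj] at h
  rw [h]
  refine Finset.sum_congr rfl fun i hi => ?_
  have := Finset.mem_range.1 hi
  rw [show n - (n - 1 - i) = i + 1 by omega, show n - (i + 1) = n - 1 - i by omega]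

lemma phi_fx (n : ℕ) : phi n fx = Xmat n := by simp [phi, fx]

lemma phi_fy (n : ℕ) : phi n fy = Ymat n := by simp [phi, fy]

lemma phi_r1 (n : ℕ) : phi n (r1 n) = 0 := by
  simp [r1, phi_fx, Xmat_pow_self]

lemma phi_r2 (n : ℕ) : phi n (r2 n) = 0 := by
  simp [r2, phi_fx, phi_fy, sum_conj_pow_eq _ (Xmat_pow_self n),
    Xmat_pow_mul_Ymat_mul_Xmat_pow, Matrix.sum_single_one]

lemma phi_s {n j : ℕ} (hj : ¬ n ∣ j) : phi n (s j) = 0 := by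
  simp [s, phi_fx, phi_fy, Ymat_mul_Xmat_pow_mul_Ymat, hj]

/-- The additive map `Mₙ(ℤ) → R` sending the matrix unit `E_{pq}` to `x ^ p * y * x ^ (n - q)`. -/
def matrixUnitsLift {R : Type*} [Ring R] (n : ℕ) (x y : R) :
    Matrix (Fin n) (Fin n) ℤ →ₗ[ℤ] R :=
  Matrix.liftLinear ℤ fun p q =>
    LinearMap.toSpanSingleton ℤ R (x ^ (p : ℕ) * y * x ^ (n - q : ℕ))

lemma matrixUnitsLift_single {R : Type*} [Ring R] {n : ℕ} (x y : R) (p q : Fin n) :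
    matrixUnitsLift n x y (Matrix.single p q 1) = x ^ (p : ℕ) * y * x ^ (n - q : ℕ) := by
  simp [matrixUnitsLift]

section Relations

variable {R : Type*} [Ring R] {n : ℕ} {x y : R}

lemma matrixUnitsLift_one (h1 : x ^ n = 1)
    (h2 : ∑ i ∈ Finset.range n, x ^ (n - i) * y * x ^ i = 1) :
    matrixUnitsLift n x y 1 = 1 := by
  rw [← Matrix.sum_single_one, map_sum, ← h2, sum_conj_pow_eq _ h1]
  simp only [matrixUnitsLift_single]

lemma isIdempotentElem_of_relations (hn : 0 < n) (h1 : x ^ n = 1)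
    (h2 : ∑ i ∈ Finset.range n, x ^ (n - i) * y * x ^ i = 1)
    (h3 : ∀ j, 1 ≤ j → j ≤ n - 1 → y * x ^ j * y = 0) : y * y = y := by
  have h := congrArg (· * y) h2
  simp only [Finset.sum_mul, one_mul] at h
  rw [Finset.sum_eq_single 0] at h
  · simpa [h1] using h
  · intro i hi hi0
    have := Finset.mem_range.1 hi
    rw [mul_assoc, mul_assoc, ← mul_assoc y, h3 i (by omega) (by omega), mul_zero]
  · intro h0
    exact absurd (Finset.mem_range.2 hn) h0

lemma mul_matrixUnitsLift_x (h1 : x ^ n = 1) (M : Matrix (Fin n) (Fin n) ℤ) :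
    x * matrixUnitsLift n x y M = matrixUnitsLift n x y (Xmat n * M) := by
  suffices LinearMap.mulLeft ℤ x ∘ₗ matrixUnitsLift n x y =
      matrixUnitsLift n x y ∘ₗ LinearMap.mulLeft ℤ (Xmat n) from LinearMap.congr_fun this M
  refine Matrix.ext_linearMap ℤ fun p q => LinearMap.ext_ring ?_
  change x * matrixUnitsLift n x y (Matrix.single p q 1) =
    matrixUnitsLift n x y (Xmat n * Matrix.single p q 1)
  simp only [Xmat_mul_single, matrixUnitsLift_single]
  rw [← pow_eq_pow_mod _ h1, pow_succ']
  simp only [mul_assoc]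

lemma mul_matrixUnitsLift_y (h : y * y = y)
    (h3 : ∀ j, 1 ≤ j → j ≤ n - 1 → y * x ^ j * y = 0) (M : Matrix (Fin n) (Fin n) ℤ) :
    y * matrixUnitsLift n x y M = matrixUnitsLift n x y (Ymat n * M) := by
  suffices LinearMap.mulLeft ℤ y ∘ₗ matrixUnitsLift n x y =
      matrixUnitsLift n x y ∘ₗ LinearMap.mulLeft ℤ (Ymat n) from LinearMap.congr_fun this M
  refine Matrix.ext_linearMap ℤ fun p q => LinearMap.ext_ring ?_
  change y * matrixUnitsLift n x y (Matrix.single p q 1) =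
    matrixUnitsLift n x y (Ymat n * Matrix.single p q 1)
  simp only [Ymat_mul_single, matrixUnitsLift_single]
  split_ifs with hp
  · rw [matrixUnitsLift_single]
    simp [hp, ← mul_assoc, h]
  · rw [map_zero, ← mul_assoc, ← mul_assoc, h3 p (by omega) (by omega), zero_mul]

end Relations

lemma eq_matrixUnitsLift_phi {R : Type*} [Ring R] {n : ℕ} (hn : 0 < n)
    (f : FreeAlgebra ℤ (Fin 2) →+* R) (h1 : f (r1 n) = 0) (h2 : f (r2 n) = 0)
    (h3 : ∀ j, 1 ≤ j → j ≤ n - 1 → f (s j) = 0) (a : FreeAlgebra ℤ (Fin 2)) :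
    f a = matrixUnitsLift n (f fx) (f fy) (phi n a) := by
  simp only [r1, r2, s, map_sub, map_sum, map_mul, map_pow, map_one, sub_eq_zero] at h1 h2 h3
  have hy := isIdempotentElem_of_relations hn h1 h2 h3
  have key : ∀ M, f a * matrixUnitsLift n (f fx) (f fy) M =
      matrixUnitsLift n (f fx) (f fy) (phi n a * M) := by
    induction a using FreeAlgebra.induction with
    | grade0 z =>
      intro M
      simp only [eq_intCast, map_intCast, ← zsmul_eq_mul, map_zsmul]
    | grade1 i =>
      intro M
      fin_cases i
      · exact (mul_matrixUnitsLift_x h1 M).trans (by rw [← phi_fx]; rfl)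
      · exact (mul_matrixUnitsLift_y hy h3 M).trans (by rw [← phi_fy]; rfl)
    | mul a b ha hb => intro M; rw [map_mul f, map_mul (phi n), mul_assoc, mul_assoc, hb, ha]
    | add a b ha hb => intro M; rw [map_add, map_add, add_mul, add_mul, map_add, ha, hb]
  simpa [matrixUnitsLift_one h1 h2] using key 1

lemma mem_Igen_iff {n : ℕ} (hn : 0 < n) (a : FreeAlgebra ℤ (Fin 2)) :
    a ∈ Igen n ↔ phi n a = 0 := by
  constructor
  · intro ha
    have hle : Igen n ≤ TwoSidedIdeal.ker (phi n) := by
      refine TwoSidedIdeal.span_le.2 ?_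
      rintro b ((rfl | rfl) | ⟨j, hj, hj', rfl⟩)
      · exact (TwoSidedIdeal.mem_ker _).2 (phi_r1 n)
      · exact (TwoSidedIdeal.mem_ker _).2 (phi_r2 n)
      · exact (TwoSidedIdeal.mem_ker _).2
          (phi_s (Nat.not_dvd_of_pos_of_lt (by omega) (by omega)))
    exact (TwoSidedIdeal.mem_ker _).1 (hle ha)
  · intro ha
    have hmem : ∀ b, (Igen n).ringCon.mk' b = 0 ↔ b ∈ Igen n := fun b => by
      rw [← TwoSidedIdeal.mem_ker, TwoSidedIdeal.ker_ringCon_mk']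
    rw [← hmem, eq_matrixUnitsLift_phi hn, ha, map_zero]
    · exact (hmem _).2 (TwoSidedIdeal.subset_span (Or.inl (Or.inl rfl)))
    · exact (hmem _).2 (TwoSidedIdeal.subset_span (Or.inl (Or.inr rfl)))
    · exact fun j hj hj' =>
        (hmem _).2 (TwoSidedIdeal.subset_span (Or.inr ⟨j, hj, hj', rfl⟩))

lemma phi_sum_smul {n m : ℕ} (M : Matrix (Fin m) (Fin m) ℤ) (h : ¬ n ∣ m) :
    phi n (∑ p, ∑ q, M p q • (fx ^ (p : ℕ) * s m * fx ^ (m - q : ℕ))) = 0 := by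
  simp [phi_s h]

lemma phi_sum_smul_self {m : ℕ} (M : Matrix (Fin m) (Fin m) ℤ) :
    phi m (∑ p, ∑ q, M p q • (fx ^ (p : ℕ) * s m * fx ^ (m - q : ℕ))) = M := by
  have hs : phi m (s m) = Ymat m := by
    simp [s, phi_fx, phi_fy, Ymat_mul_Xmat_pow_mul_Ymat]
  conv_rhs => rw [Matrix.matrix_eq_sum_single M]
  simp [hs, phi_fx, Xmat_pow_mul_Ymat_mul_Xmat_pow, Matrix.smul_single, -zsmul_eq_mul]

theorem stmt_14 (k : ℕ) (hk : 1 ≤ k) (n : Fin k → ℕ) (hn : ∀ j, 2 ≤ n j)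
    (hcop : ∀ i j, i ≠ j → Nat.Coprime (n i) (n j)) :
    Function.Surjective
        (fun a : FreeAlgebra ℤ (Fin 2) => fun j : Fin k => phi (n j) a) ∧
      ∀ a : FreeAlgebra ℤ (Fin 2),
        ((fun j : Fin k => phi (n j) a) = 0 ↔ a ∈ ⨅ j : Fin k, Igen (n j)) := by
  constructor
  · intro M
    refine ⟨∑ j, ∑ p, ∑ q, M j p q • (fx ^ (p : ℕ) * s (n j) * fx ^ (n j - q : ℕ)), ?_⟩
    funext i
    simp only
    rw [map_sum, Finset.sum_eq_single i, phi_sum_smul_self]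
    · intro j _ hj
      refine phi_sum_smul _ fun hd => ?_
      have := Nat.Coprime.eq_one_of_dvd (hcop i j hj.symm) hd
      have := hn i
      omega
    · simp
  · intro a
    rw [TwoSidedIdeal.mem_iInf, funext_iff]
    exact forall_congr' fun j => (mem_Igen_iff (by have := hn j; omega) a).symm
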